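/- Let M1 ≥ 1, M2 ≥ 1, N2 ≥ 1 be integers, E1 = 2M1 + (M1+1)(M2−1), E2 = 2E1 + N2(2E1+1), S1 the CNA sensor set with parameters M1, M2, and S2 = {2E1 + i(2E1+1) : 1 ≤ i ≤ N2}. Then the difference co-array of the set (S1 + S1) ∪ S2, where S1 + S1 = {a + b : a, b ∈ S1}, is the full hole-free range: {x − y : x, y ∈ (S1 + S1) ∪ S2} = {μ ∈ ℤ : −E2 ≤ μ ≤ E2}. -/

import Mathlib

/-- Concatenated nested array (CNA) with parameters M1, M2. -/
def CNA (M1 M2 : ℤ) : Set ℤ :=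
  Set.Icc 0 (M1 - 1) ∪
  {x | ∃ k, 0 ≤ k ∧ k ≤ M2 - 1 ∧ x = M1 + k * (M1 + 1)} ∪
  {x | ∃ j, 1 ≤ j ∧ j ≤ M1 ∧ x = M1 + (M1 + 1) * (M2 - 1) + j}

theorem mem_CNA_of_le {M1 M2 x : ℤ} (hM2 : 1 ≤ M2) (h0 : 0 ≤ x) (h1 : x ≤ M1) :
    x ∈ CNA M1 M2 := by
  rcases h1.lt_or_eq with h | rfl
  · exact Or.inl (Or.inl ⟨h0, by omega⟩)
  · exact Or.inl (Or.inr ⟨0, le_rfl, by omega, by ring⟩)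

theorem grid_mem_CNA {M1 M2 k : ℤ} (h0 : 0 ≤ k) (h1 : k ≤ M2 - 1) :
    M1 + k * (M1 + 1) ∈ CNA M1 M2 :=
  Or.inl (Or.inr ⟨k, h0, h1, rfl⟩)

theorem add_mem_CNA_of_le {M1 M2 j : ℤ} (hM2 : 1 ≤ M2) (h0 : 0 ≤ j) (h1 : j ≤ M1) :
    M1 + (M1 + 1) * (M2 - 1) + j ∈ CNA M1 M2 := by
  rcases h0.lt_or_eq with h | rfl
  · exact Or.inr ⟨j, by omega, h1, rfl⟩
  · exact Or.inl (Or.inr ⟨M2 - 1, by omega, le_rfl, by ring⟩)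

theorem CNA_subset_Icc {M1 M2 : ℤ} (hM1 : 1 ≤ M1) (hM2 : 1 ≤ M2) :
    CNA M1 M2 ⊆ Set.Icc 0 (2 * M1 + (M1 + 1) * (M2 - 1)) := by
  have hL : 0 ≤ (M1 + 1) * (M2 - 1) := mul_nonneg (by omega) (by omega)
  rintro x ((⟨h0, h1⟩ | ⟨k, h0, h1, rfl⟩) | ⟨j, h0, h1, rfl⟩)
  · constructor <;> linarith
  · have : 0 ≤ k * (M1 + 1) := mul_nonneg h0 (by omega)
    have : k * (M1 + 1) ≤ (M2 - 1) * (M1 + 1) := mul_le_mul_of_nonneg_right h1 (by omega)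
    constructor <;> linarith
  · constructor <;> linarith

/-- Every `y` in `[0, M1 + (M1 + 1)(M2 - 1)]` is a grid multiple plus a remainder at most `M1`. -/
theorem exists_grid_add {M1 M2 y : ℤ} (hM1 : 1 ≤ M1) (h0 : 0 ≤ y)
    (h1 : y ≤ M1 + (M1 + 1) * (M2 - 1)) :
    ∃ k r, 0 ≤ k ∧ k ≤ M2 - 1 ∧ 0 ≤ r ∧ r ≤ M1 ∧ y = k * (M1 + 1) + r := by
  refine ⟨y / (M1 + 1), y % (M1 + 1), Int.ediv_nonneg h0 (by omega), ?_,
    Int.emod_nonneg _ (by omega), ?_, (Int.ediv_mul_add_emod y (M1 + 1)).symm⟩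
  · have : y / (M1 + 1) < M2 := Int.ediv_lt_of_lt_mul (by omega) (by linarith)
    omega
  · have := Int.emod_lt_of_pos y (show 0 < M1 + 1 by omega)
    omega

/-- The sum co-array of the CNA is hole-free. -/
theorem sumCoarray_CNA {M1 M2 : ℤ} (hM1 : 1 ≤ M1) (hM2 : 1 ≤ M2) :
    {x : ℤ | ∃ a ∈ CNA M1 M2, ∃ b ∈ CNA M1 M2, x = a + b} =
      Set.Icc 0 (2 * (2 * M1 + (M1 + 1) * (M2 - 1))) := by
  ext x
  constructor
  · rintro ⟨a, ha, b, hb, rfl⟩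
    have ha' := CNA_subset_Icc hM1 hM2 ha
    have hb' := CNA_subset_Icc hM1 hM2 hb
    exact ⟨by linarith [ha'.1, hb'.1], by linarith [ha'.2, hb'.2]⟩
  · rintro ⟨h0, h1⟩
    by_cases hx1 : x < M1
    · exact ⟨x, mem_CNA_of_le hM2 h0 hx1.le, 0, mem_CNA_of_le hM2 le_rfl (by omega), by ring⟩
    by_cases hx2 : x ≤ 2 * M1 + (M1 + 1) * (M2 - 1)
    · obtain ⟨k, r, hk0, hk1, hr0, hr1, h⟩ :=
        exists_grid_add (M2 := M2) (y := x - M1) hM1 (by linarith) (by linarith)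
      exact ⟨_, grid_mem_CNA hk0 hk1, r, mem_CNA_of_le hM2 hr0 hr1, by linarith⟩
    by_cases hx3 : x ≤ 3 * M1 + 2 * ((M1 + 1) * (M2 - 1))
    · obtain ⟨k, r, hk0, hk1, hr0, hr1, h⟩ :=
        exists_grid_add (M2 := M2) (y := x - (2 * M1 + (M1 + 1) * (M2 - 1))) hM1
          (by linarith) (by linarith)
      exact ⟨_, grid_mem_CNA hk0 hk1, _, add_mem_CNA_of_le hM2 hr0 hr1, by linarith⟩
    · exact ⟨_, add_mem_CNA_of_le hM2 (by omega) le_rfl, _,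
        add_mem_CNA_of_le (j := x - (3 * M1 + 2 * ((M1 + 1) * (M2 - 1)))) hM2
          (by linarith) (by linarith), by ring⟩

/-- Adjoining to `[0, E]` the translates `E + i(E + 1)`, `1 ≤ i ≤ N`, gives a set whose
differences cover `[0, E + N(E + 1)]`. -/
theorem exists_sub_of_mem_Icc {E N x : ℤ} (hE : 0 ≤ E) (h0 : 0 ≤ x)
    (h1 : x ≤ E + N * (E + 1)) :
    ∃ p ∈ Set.Icc 0 E ∪ {x | ∃ i, 1 ≤ i ∧ i ≤ N ∧ x = E + i * (E + 1)},
      ∃ q ∈ Set.Icc 0 E, x = p - q := by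
  have hi0 : 0 ≤ x / (E + 1) := Int.ediv_nonneg h0 (by omega)
  have hiN : x / (E + 1) < N + 1 := Int.ediv_lt_of_lt_mul (by omega) (by linarith)
  have hx := Int.ediv_mul_add_emod x (E + 1)
  have hr0 := Int.emod_nonneg x (show E + 1 ≠ 0 by omega)
  have hr1 := Int.emod_lt_of_pos x (show 0 < E + 1 by omega)
  refine ⟨E + x / (E + 1) * (E + 1), ?_, E - x % (E + 1), ⟨by omega, by omega⟩, by linarith⟩
  rcases hi0.lt_or_eq with h | h
  · exact Or.inr ⟨_, h, by omega, rfl⟩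
  · rw [← h]
    exact Or.inl ⟨by omega, by omega⟩

/-- The difference co-array of `(S1 + S1) ∪ S2`, where S1 is the CNA and
`S2 = {2E1 + i(2E1+1) : 1 ≤ i ≤ N2}`, is the full hole-free range `{−E2,…,E2}`. -/
theorem sumcoarray_union_s2_difference_hole_free
    (M1 M2 N2 : ℤ) (hM1 : 1 ≤ M1) (hM2 : 1 ≤ M2) (hN2 : 1 ≤ N2)
    (E1 E2 : ℤ) (hE1 : E1 = 2 * M1 + (M1 + 1) * (M2 - 1))
    (hE2 : E2 = 2 * E1 + N2 * (2 * E1 + 1))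
    (S1 S2 V : Set ℤ) (hS1 : S1 = CNA M1 M2)
    (hS2 : S2 = {x | ∃ i, 1 ≤ i ∧ i ≤ N2 ∧ x = 2 * E1 + i * (2 * E1 + 1)})
    (hV : V = {x : ℤ | ∃ a ∈ S1, ∃ b ∈ S1, x = a + b} ∪ S2) :
    {x : ℤ | ∃ p ∈ V, ∃ q ∈ V, x = p - q} = Set.Icc (-E2) E2 := by
  have hE : 0 ≤ 2 * E1 := by
    have : 0 ≤ (M1 + 1) * (M2 - 1) := mul_nonneg (by omega) (by omega)
    omega
  rw [hS1, sumCoarray_CNA hM1 hM2, ← hE1, hS2] at hV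
  have hV' : V ⊆ Set.Icc 0 E2 := by
    rw [hV, hE2]
    rintro x (⟨h0, h1⟩ | ⟨i, h0, h1, rfl⟩)
    · have : 0 ≤ N2 * (2 * E1 + 1) := mul_nonneg (by omega) (by omega)
      constructor <;> linarith
    · have : 0 ≤ i * (2 * E1 + 1) := mul_nonneg (by omega) (by omega)
      have : i * (2 * E1 + 1) ≤ N2 * (2 * E1 + 1) := mul_le_mul_of_nonneg_right h1 (by omega)
      constructor <;> linarith
  have hcover : ∀ x, 0 ≤ x → x ≤ E2 → ∃ p ∈ V, ∃ q ∈ V, x = p - q := by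
    intro x h0 h1
    obtain ⟨p, hp, q, hq, h⟩ := exists_sub_of_mem_Icc hE h0 (h1.trans_eq hE2)
    rw [hV]
    exact ⟨p, hp, q, Or.inl hq, h⟩
  ext x
  constructor
  · rintro ⟨p, hp, q, hq, rfl⟩
    have hp' := hV' hp
    have hq' := hV' hq
    exact ⟨by linarith [hp'.1, hq'.2], by linarith [hp'.2, hq'.1]⟩
  · rintro ⟨h0, h1⟩
    rcases le_total 0 x with h | h
    · exact hcover x h h1
    · obtain ⟨p, hp, q, hq, hx⟩ := hcover (-x) (by omega) (by omega)
      exact ⟨q, hq, p, hp, by omega⟩
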